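/- arXiv:math/0703668 — 3 statements merged into one kernel-verified Lean document; each statement's English description precedes it below -/
import Mathlib

section
/- For every real number C ≥ 1 there exists a constant C' ≥ 0 with the following property: for every n ≥ 1 and all sets A, B ⊆ F_2^n with H_1(n) ⊆ B ⊆ A and |A| ≤ n^C, one has |A + B| ≥ (n/2 − C'·√n·log₂ n)·|B|. -/
open Finset Pointwise

abbrev F2 (n : ℕ) := Fin n → ZMod 2

/-- The standard basis vector `e i` of `F_2^n`. -/
def stdBasis {n : ℕ} (i : Fin n) : F2 n := Pi.single i 1

/-- `A` is a downset: whenever `x i = 0` and `x + e i ∈ A`, also `x ∈ A`. -/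
def IsDownset {n : ℕ} (A : Finset (F2 n)) : Prop :=
  ∀ x : F2 n, ∀ i : Fin n, x i = 0 → x + stdBasis i ∈ A → x ∈ A

/-- `A` is shift-minimal: whenever `i < j`, `x i = x j = 0` and `x + e j ∈ A`,
also `x + e i ∈ A`. -/
def IsShiftMinimal {n : ℕ} (A : Finset (F2 n)) : Prop :=
  ∀ x : F2 n, ∀ i j : Fin n, i < j → x i = 0 → x j = 0 →
    x + stdBasis j ∈ A → x + stdBasis i ∈ A

/-- The Hamming ball of radius `r` in `F_2^n`. -/
def hamBall (n r : ℕ) : Finset (F2 n) := Finset.univ.filter fun x => hammingNorm x ≤ r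

/-- The action of the compression in direction `v`, towards `x j = 0`, on a point of `A`. -/
def compressPoint {n : ℕ} (v : F2 n) (j : Fin n) (A : Finset (F2 n)) (a : F2 n) : F2 n :=
  if a j = 1 ∧ a + v ∉ A then a + v else a

/-- The compression of `A` in direction `v`, towards `x j = 0`. -/
def compression {n : ℕ} (v : F2 n) (j : Fin n) (A : Finset (F2 n)) : Finset (F2 n) :=
  A.image (compressPoint v j A)

lemma add_add_cancel_F2 {n : ℕ} (x v : F2 n) : x + v + v = x := by
  ext i
  rw [Pi.add_apply, Pi.add_apply, add_assoc, CharTwo.add_self_eq_zero, add_zero]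

lemma zmod_two_cases (a : ZMod 2) : a = 0 ∨ a = 1 := by
  revert a; decide

lemma mem_compression {n : ℕ} {v : F2 n} {j : Fin n} (hv : v j = 1) {A : Finset (F2 n)}
    {x : F2 n} :
    x ∈ compression v j A ↔ (x ∈ A ∧ x + v ∈ A) ∨ (x j = 0 ∧ (x ∈ A ∨ x + v ∈ A)) := by
  simp only [compression, mem_image, compressPoint]
  constructor
  · rintro ⟨a, ha, rfl⟩
    split_ifs with h
    · right
      refine ⟨?_, Or.inr ?_⟩
      · rw [Pi.add_apply, h.1, hv]; decide
      · rwa [add_add_cancel_F2]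
    · rcases zmod_two_cases (a j) with h0 | h1
      · exact Or.inr ⟨h0, Or.inl ha⟩
      · exact Or.inl ⟨ha, by tauto⟩
  · rintro (⟨h1, h2⟩ | ⟨h0, h⟩)
    · exact ⟨x, h1, by simp [h2]⟩
    · by_cases hx : x ∈ A
      · exact ⟨x, hx, by simp [h0]⟩
      · refine ⟨x + v, by tauto, ?_⟩
        rw [add_add_cancel_F2, if_pos]
        exact ⟨by rw [Pi.add_apply, h0, hv]; decide, hx⟩

lemma compressPoint_injOn {n : ℕ} (v : F2 n) (j : Fin n) (A : Finset (F2 n)) :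
    Set.InjOn (compressPoint v j A) A := by
  intro a ha b hb hab
  simp only [compressPoint] at hab
  split_ifs at hab with h1 h2 h2
  · exact add_right_cancel hab
  · exact absurd (hab ▸ hb) h1.2
  · exact absurd (hab ▸ ha) h2.2
  · exact hab

lemma card_compression {n : ℕ} (v : F2 n) (j : Fin n) (A : Finset (F2 n)) :
    (compression v j A).card = A.card :=
  card_image_of_injOn (compressPoint_injOn v j A)

lemma compression_add_subset {n : ℕ} {v : F2 n} {j : Fin n} (hv : v j = 1)
    (A : Finset (F2 n)) :
    compression v j A + compression v j A ⊆ compression v j (A + A) := by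
  intro z hz
  obtain ⟨x, hx, y, hy, rfl⟩ := mem_add.1 hz
  rw [mem_compression hv] at hx hy ⊢
  have e1 : x + y + v = (x + v) + y := by abel
  have e2 : x + y + v = x + (y + v) := by abel
  have e3 : x + y = (x + v) + (y + v) := by
    rw [← add_add_cancel_F2 (x + y) v]; abel
  have key : ∀ a b : F2 n, a ∈ A → b ∈ A → a + b ∈ A + A := fun a b => add_mem_add
  rcases hx with ⟨hx, hx'⟩ | ⟨hx0, hx⟩
  · rcases hy with ⟨hy, hy'⟩ | ⟨hy0, hy | hy⟩
    · exact Or.inl ⟨key _ _ hx hy, e1 ▸ key _ _ hx' hy⟩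
    · exact Or.inl ⟨key _ _ hx hy, e1 ▸ key _ _ hx' hy⟩
    · exact Or.inl ⟨e3 ▸ key _ _ hx' hy, e2 ▸ key _ _ hx hy⟩
  · rcases hy with ⟨hy, hy'⟩ | ⟨hy0, hy⟩
    · rcases hx with hx | hx
      · exact Or.inl ⟨key _ _ hx hy, e2 ▸ key _ _ hx hy'⟩
      · exact Or.inl ⟨e3 ▸ key _ _ hx hy', e1 ▸ key _ _ hx hy⟩
    · refine Or.inr ⟨by simp [hx0, hy0], ?_⟩
      rcases hx with hx | hx <;> rcases hy with hy | hy
      · exact Or.inl (key _ _ hx hy)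
      · exact Or.inr (e2 ▸ key _ _ hx hy)
      · exact Or.inr (e1 ▸ key _ _ hx hy)
      · exact Or.inl (e3 ▸ key _ _ hx hy)

/-- The weight `∑ i, (i + 1) x i`, which compressions decrease. -/
def coordWeight {n : ℕ} (x : F2 n) : ℕ := ∑ i, (x i).val * (i.val + 1)

lemma coordWeight_add_stdBasis {n : ℕ} (x : F2 n) (i : Fin n) :
    coordWeight (x + stdBasis i) + (x i).val * (i.val + 1) =
      coordWeight x + (x i + 1).val * (i.val + 1) := by
  have h : ∑ k ∈ univ.erase i, ((x + stdBasis i) k).val * (k.val + 1) =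
      ∑ k ∈ univ.erase i, (x k).val * (k.val + 1) := by
    refine sum_congr rfl fun k hk => ?_
    simp [stdBasis, Pi.single_eq_of_ne (ne_of_mem_erase hk)]
  unfold coordWeight
  rw [← add_sum_erase univ _ (mem_univ i), ← add_sum_erase univ (fun k => (x k).val * _)
    (mem_univ i), h]
  simp [stdBasis]
  ring

lemma coordWeight_add_stdBasis_of_one {n : ℕ} {x : F2 n} {j : Fin n} (hx : x j = 1) :
    coordWeight (x + stdBasis j) + (j.val + 1) = coordWeight x := by
  have h := coordWeight_add_stdBasis x j
  rw [hx, show ((1 : ZMod 2) + 1).val = 0 from rfl, show (1 : ZMod 2).val = 1 from rfl] at h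
  omega

lemma coordWeight_add_stdBasis_le {n : ℕ} (x : F2 n) (i : Fin n) :
    coordWeight (x + stdBasis i) ≤ coordWeight x + (i.val + 1) := by
  have h := coordWeight_add_stdBasis x i
  rcases zmod_two_cases (x i) with h0 | h0
  · rw [h0, show ((0 : ZMod 2) + 1).val = 1 from rfl, show (0 : ZMod 2).val = 0 from rfl] at h
    omega
  · have := coordWeight_add_stdBasis_of_one h0
    omega

lemma hammingNorm_stdBasis_le {n : ℕ} (i : Fin n) : hammingNorm (stdBasis i) ≤ 1 := by
  unfold hammingNorm
  rw [card_le_one]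
  intro a ha b hb
  simp only [stdBasis, mem_filter, mem_univ, true_and, ne_eq, Pi.single_apply] at ha hb
  split_ifs at ha hb <;> simp_all

lemma stdBasis_mem_of_hamBall_subset {n : ℕ} {B : Finset (F2 n)} (h : hamBall n 1 ⊆ B)
    (i : Fin n) : stdBasis i ∈ B :=
  h (by simpa [hamBall] using hammingNorm_stdBasis_le i)

lemma zero_mem_of_hamBall_subset {n : ℕ} {B : Finset (F2 n)} (h : hamBall n 1 ⊆ B) :
    (0 : F2 n) ∈ B :=
  h (by simp [hamBall])

/-- A finite set containing the coordinate vectors can be replaced by a compressed one of the same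
size without increasing its doubling. -/
lemma exists_compressed {n : ℕ} (B : Finset (F2 n)) (h0 : (0 : F2 n) ∈ B)
    (h1 : ∀ i, stdBasis i ∈ B) :
    ∃ B' : Finset (F2 n), B'.card = B.card ∧ (B' + B').card ≤ (B + B).card ∧ 0 ∈ B' ∧
      (∀ i, stdBasis i ∈ B') ∧ (∀ x ∈ B', ∀ j, x j = 1 → x + stdBasis j ∈ B') ∧
      (∀ x ∈ B', ∀ i j, i < j → x j = 1 → x + (stdBasis i + stdBasis j) ∈ B') := by
  classical
  let F : Finset (Finset (F2 n)) := univ.filter fun B' =>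
    B'.card = B.card ∧ (B' + B').card ≤ (B + B).card ∧ 0 ∈ B' ∧ ∀ i, stdBasis i ∈ B'
  obtain ⟨B', hB', hmin⟩ := exists_min_image F (fun B' => ∑ x ∈ B', coordWeight x)
    ⟨B, by simp only [F, mem_filter, mem_univ, true_and, le_refl]; exact ⟨h0, h1⟩⟩
  have hF := hB'
  simp only [F, mem_filter, mem_univ, true_and] at hF
  obtain ⟨hc, hs, hz, he⟩ := hF
  have key : ∀ (v : F2 n) (j : Fin n), v j = 1 →
      (∀ x : F2 n, x j = 1 → coordWeight (x + v) < coordWeight x) →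
      stdBasis j + v ∈ B' → ∀ x ∈ B', x j = 1 → x + v ∈ B' := by
    intro v j hv hw hj x hx hxj
    by_contra hxv
    have hmem : compression v j B' ∈ F := by
      simp only [F, mem_filter, mem_univ, true_and]
      refine ⟨(card_compression _ _ _).trans hc, ?_, ?_, ?_⟩
      · exact ((card_le_card (compression_add_subset hv B')).trans
          (card_compression _ _ _).le).trans hs
      · exact (mem_compression hv).2 (Or.inr ⟨rfl, Or.inl hz⟩)
      · intro i
        rw [mem_compression hv]
        by_cases hij : i = j
        · subst hij
          exact Or.inl ⟨he _, hj⟩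
        · refine Or.inr ⟨?_, Or.inl (he i)⟩
          simp [stdBasis, Pi.single_eq_of_ne (Ne.symm hij)]
    refine absurd (hmin _ hmem) (not_le.2 ?_)
    unfold compression
    rw [sum_image (compressPoint_injOn v j B')]
    refine sum_lt_sum (fun a _ => ?_) ⟨x, hx, ?_⟩
    · unfold compressPoint
      split_ifs with h
      · exact (hw a h.1).le
      · exact le_rfl
    · rw [compressPoint, if_pos ⟨hxj, hxv⟩]
      exact hw x hxj
  refine ⟨B', hc, hs, hz, he, fun x hx j hxj => ?_, fun x hx i j hij hxj => ?_⟩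
  · refine key (stdBasis j) j (by simp [stdBasis]) (fun y hy => ?_) ?_ x hx hxj
    · have := coordWeight_add_stdBasis_of_one hy
      omega
    · have e := add_add_cancel_F2 0 (stdBasis j)
      rw [zero_add] at e
      rwa [e]
  · refine key (stdBasis i + stdBasis j) j ?_ (fun y hy => ?_) ?_ x hx hxj
    · simp [stdBasis, Pi.single_eq_of_ne hij.ne']
    · have h1 := coordWeight_add_stdBasis_of_one hy
      have h2 := coordWeight_add_stdBasis_le (y + stdBasis j) i
      rw [show y + (stdBasis i + stdBasis j) = y + stdBasis j + stdBasis i by abel]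
      have : i.val < j.val := hij
      omega
    · rw [show stdBasis j + (stdBasis i + stdBasis j) = stdBasis i + stdBasis j + stdBasis j by
        abel, add_add_cancel_F2]
      exact he i

/-- The indicator vector of a set of coordinates. -/
def indVec {n : ℕ} (s : Finset (Fin n)) : F2 n := fun i => if i ∈ s then 1 else 0

lemma indVec_injective {n : ℕ} : Function.Injective (indVec (n := n)) := by
  intro s t h
  ext i
  have := congrFun h i
  simp only [indVec] at this
  split_ifs at this <;> simp_all

lemma indVec_filter {n : ℕ} (x : F2 n) : indVec (univ.filter fun i => x i = 1) = x := by
  ext i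
  rcases zmod_two_cases (x i) with h | h <;> simp [indVec, h]

lemma indVec_union {n : ℕ} {s t : Finset (Fin n)} (h : Disjoint s t) :
    indVec (s ∪ t) = indVec s + indVec t := by
  ext i
  have : i ∈ s → i ∉ t := fun hi => disjoint_left.1 h hi
  by_cases h1 : i ∈ s <;> by_cases h2 : i ∈ t <;> simp_all [indVec]

lemma indVec_add_stdBasis_of_mem {n : ℕ} {s : Finset (Fin n)} {j : Fin n} (h : j ∈ s) :
    indVec s + stdBasis j = indVec (s.erase j) := by
  ext i
  by_cases hij : i = j
  · subst hij
    simp only [indVec, stdBasis, Pi.add_apply, if_pos h, Pi.single_eq_same, notMem_erase, if_false]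
    decide
  · simp [indVec, stdBasis, hij]

lemma indVec_add_stdBasis_of_notMem {n : ℕ} {s : Finset (Fin n)} {j : Fin n} (h : j ∉ s) :
    indVec s + stdBasis j = indVec (insert j s) := by
  ext i
  by_cases hij : i = j
  · subst hij
    simp [indVec, stdBasis, h]
  · simp [indVec, stdBasis, hij]

section Families

variable {n : ℕ} {𝓑 𝓓 : Finset (Finset (Fin n))}

/-- Counting sets `insert j s`, with `s` having few elements beyond `T` and `j` beyond `T`. -/
lemma card_level_mul_le (hD : ∀ s ∈ 𝓑, ∀ j ∉ s, insert j s ∈ 𝓓) (T k : ℕ) :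
    (𝓑.filter fun s => (s.filter fun i => T ≤ i.val).card = k).card * (n - T - k) ≤
      (𝓓.filter fun s => (s.filter fun i => T ≤ i.val).card = k + 1).card * (k + 1) := by
  classical
  refine card_mul_le_card_mul (fun s z => ∃ j, j ∉ s ∧ T ≤ j.val ∧ z = insert j s) ?_ ?_
  · intro s hs
    simp only [mem_filter] at hs
    have hcard : n - T - k ≤ (univ.filter fun j : Fin n => T ≤ j.val ∧ j ∉ s).card := by
      have e : (univ.filter fun j : Fin n => T ≤ j.val ∧ j ∉ s) =
          (univ.filter fun j : Fin n => T ≤ j.val) \ s.filter fun i => T ≤ i.val := by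
        ext j; simp only [mem_filter, mem_sdiff, mem_univ, true_and]; tauto
      have h1 : (univ.filter fun j : Fin n => T ≤ j.val).card = n - T := by
        have h2 := card_filter_add_card_filter_not (s := (univ : Finset (Fin n)))
          (fun j => j.val < T)
        have h3 : (univ.filter fun j : Fin n => j.val < T).card = min n T :=
          Fin.card_filter_val_lt
        simp only [not_lt, card_univ, Fintype.card_fin] at h2
        omega
      rw [e]
      have := le_card_sdiff (s.filter fun i => T ≤ i.val) (univ.filter fun j : Fin n => T ≤ j.val)
      omega
    refine hcard.trans ?_
    rw [← card_image_of_injOn (f := fun j => insert j s)]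
    · refine card_le_card fun z hz => ?_
      simp only [mem_image, mem_filter, mem_univ, true_and] at hz
      obtain ⟨j, ⟨hj, hjs⟩, rfl⟩ := hz
      simp only [mem_bipartiteAbove, mem_filter]
      refine ⟨⟨hD s hs.1 j hjs, ?_⟩, j, hjs, hj, rfl⟩
      rw [filter_insert, if_pos hj, card_insert_of_notMem (by simp [hjs]), hs.2]
    · intro a ha b hb hab
      simp only [coe_filter, Set.mem_ofPred_eq, mem_univ, true_and] at ha hb
      exact (insert_inj ha.2).1 hab
  · intro z hz
    simp only [mem_filter] at hz
    rw [← hz.2]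
    refine (card_le_card ?_).trans (card_image_le (f := fun j => z.erase j))
    intro s hs
    simp only [mem_bipartiteBelow, mem_filter] at hs
    obtain ⟨_, j, hj, hjT, rfl⟩ := hs
    simp only [mem_image, mem_filter]
    exact ⟨j, ⟨mem_insert_self _ _, hjT⟩, erase_insert hj⟩

/-- Counting sets `insert j s`, with `s` contained in `[0, h)` and `j` beyond `h`. -/
lemma card_bounded_mul_le (hD : ∀ s ∈ 𝓑, ∀ j ∉ s, insert j s ∈ 𝓓) (T h : ℕ) :
    (𝓑.filter fun s => 2 ≤ (s.filter fun i => T ≤ i.val).card ∧ ∀ i ∈ s, i.val < h).card *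
        (n - h) ≤
      (𝓓.filter fun s => 3 ≤ (s.filter fun i => T ≤ i.val).card).card := by
  classical
  rw [← mul_one (card (𝓓.filter _))]
  refine card_mul_le_card_mul (fun s z => ∃ j, (∀ i ∈ s, i < j) ∧ z = insert j s) ?_ ?_
  · intro s hs
    simp only [mem_filter] at hs
    have hns : ∀ j : Fin n, h ≤ j.val → j ∉ s := fun j hj hjs => by
      have := hs.2.2 j hjs
      omega
    have hcard : n - h ≤ (univ.filter fun j : Fin n => h ≤ j.val).card := by
      have h2 := card_filter_add_card_filter_not (s := (univ : Finset (Fin n)))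
        (fun j => j.val < h)
      have h3 : (univ.filter fun j : Fin n => j.val < h).card = min n h :=
        Fin.card_filter_val_lt
      simp only [not_lt, card_univ, Fintype.card_fin] at h2
      omega
    refine hcard.trans ?_
    rw [← card_image_of_injOn (f := fun j => insert j s)]
    · refine card_le_card fun z hz => ?_
      simp only [mem_image, mem_filter, mem_univ, true_and] at hz
      obtain ⟨j, hj, rfl⟩ := hz
      simp only [mem_bipartiteAbove, mem_filter]
      have hlt : ∀ i ∈ s, i < j := fun i hi =>
        show i.val < j.val from lt_of_lt_of_le (hs.2.2 i hi) hj
      refine ⟨⟨hD s hs.1 j (hns j hj), ?_⟩, j, hlt, rfl⟩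
      obtain ⟨i, hi⟩ : (s.filter fun i => T ≤ i.val).Nonempty := by
        rw [← card_pos]; omega
      simp only [mem_filter] at hi
      have hjT : T ≤ j.val := hi.2.trans (hlt i hi.1).le
      rw [filter_insert, if_pos hjT, card_insert_of_notMem (by simp [hns j hj])]
      omega
    · intro a ha b hb hab
      simp only [coe_filter, Set.mem_ofPred_eq, mem_univ, true_and] at ha hb
      exact (insert_inj (hns a ha)).1 hab
  · intro z hz
    rw [card_le_one]
    intro s hs t ht
    simp only [mem_bipartiteBelow, mem_filter] at hs ht
    obtain ⟨_, j, hj, rfl⟩ := hs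
    obtain ⟨_, k, hk, hjk⟩ := ht
    have hjs : j ∉ s := fun h => lt_irrefl _ (hj j h)
    have hkt : k ∉ t := fun h => lt_irrefl _ (hk k h)
    have e : j = k := by
      by_contra hne
      have h1 : j ∈ insert k t := hjk ▸ mem_insert_self j s
      have h2 : k ∈ insert j s := hjk ▸ mem_insert_self k t
      have h3 := hk j ((mem_insert.1 h1).resolve_left hne)
      have h4 := hj k ((mem_insert.1 h2).resolve_left (Ne.symm hne))
      exact lt_asymm h3 h4
    subst e
    rw [← erase_insert hjs, hjk, erase_insert hkt]

/-- Counting sets `s ∪ {i, j}` with `i < T ≤ j < h`. -/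
lemma card_mul_le_of_insert_pairs {𝓢 : Finset (Finset (Fin n))} {K T h : ℕ} (hT : T ≤ n)
    (hh : h ≤ n) (hK : ∀ s ∈ 𝓢, s.card ≤ K)
    (hD : ∀ s ∈ 𝓢, ∀ i j : Fin n, i.val < T → T ≤ j.val → j.val < h → i ∉ s → j ∉ s →
      insert i (insert j s) ∈ 𝓓) :
    𝓢.card * ((T - K) * (h - T - K)) ≤ 𝓓.card * (K + 2) ^ 2 := by
  classical
  refine le_trans (b := (𝓓.filter fun z => z.card ≤ K + 2).card * (K + 2) ^ 2) ?_
    (Nat.mul_le_mul_right _ (card_filter_le _ _))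
  refine card_mul_le_card_mul (fun s z => ∃ i j : Fin n, i.val < T ∧ T ≤ j.val ∧ i ∉ s ∧ j ∉ s ∧
    z = insert i (insert j s)) ?_ ?_
  · intro s hs
    have hsK := hK s hs
    have h1 : T - K ≤ ((univ.filter fun i : Fin n => i.val < T) \ s).card := by
      have := le_card_sdiff s (univ.filter fun i : Fin n => i.val < T)
      have h3 : (univ.filter fun j : Fin n => j.val < T).card = min n T :=
        Fin.card_filter_val_lt
      omega
    have h2 : h - T - K ≤ ((univ.filter fun j : Fin n => T ≤ j.val ∧ j.val < h) \ s).card := by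
      have := le_card_sdiff s (univ.filter fun j : Fin n => T ≤ j.val ∧ j.val < h)
      have h3 : (univ.filter fun j : Fin n => j.val < T).card = min n T :=
        Fin.card_filter_val_lt
      have h4 : (univ.filter fun j : Fin n => j.val < h).card = min n h :=
        Fin.card_filter_val_lt
      have h5 : (univ.filter fun j : Fin n => j.val < h).card ≤
          (univ.filter fun j : Fin n => j.val < T).card +
          (univ.filter fun j : Fin n => T ≤ j.val ∧ j.val < h).card := by
        refine (card_le_card fun j hj => ?_).trans (card_union_le _ _)
        simp only [mem_union, mem_filter, mem_univ, true_and] at hj ⊢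
        omega
      omega
    refine (Nat.mul_le_mul h1 h2).trans ?_
    rw [← card_product, ← card_image_of_injOn (f := fun p : Fin n × Fin n =>
      insert p.1 (insert p.2 s))]
    · refine card_le_card fun z hz => ?_
      simp only [mem_image, mem_product, mem_sdiff, mem_filter, mem_univ, true_and] at hz
      obtain ⟨⟨i, j⟩, ⟨⟨hi, his⟩, ⟨hj, hjh⟩, hjs⟩, rfl⟩ := hz
      simp only [mem_bipartiteAbove, mem_filter]
      refine ⟨⟨hD s hs i j hi hj hjh his hjs, ?_⟩, i, j, hi, hj, his, hjs, rfl⟩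
      have := card_insert_le i (insert j s)
      have := card_insert_le j s
      omega
    · rintro ⟨i, j⟩ hp ⟨i', j'⟩ hp' e
      simp only [coe_product, Set.mem_prod, mem_coe, mem_sdiff, mem_filter, mem_univ,
        true_and] at hp hp' e
      have hii : i ∈ insert i' (insert j' s) := e ▸ mem_insert_self _ _
      have hjj : j ∈ insert i' (insert j' s) := e ▸ mem_insert_of_mem (mem_insert_self _ _)
      simp only [mem_insert, hp.1.2, hp.2.2, or_false] at hii hjj
      have a1 : i = i' := hii.resolve_right fun h => by
        have := congrArg Fin.val h; omega
      have a2 : j = j' := hjj.resolve_left fun h => by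
        have := congrArg Fin.val h; omega
      rw [a1, a2]
  · intro z hz
    simp only [mem_filter] at hz
    refine le_trans (b := z.card * z.card) ?_ (by rw [sq]; exact Nat.mul_le_mul hz.2 hz.2)
    rw [← card_product]
    refine (card_le_card ?_).trans (card_image_le (f := fun p : Fin n × Fin n =>
      (z.erase p.1).erase p.2))
    intro s hs
    simp only [mem_bipartiteBelow] at hs
    obtain ⟨_, i, j, hi, hj, his, hjs, rfl⟩ := hs
    simp only [mem_image, mem_product]
    refine ⟨(i, j), ⟨mem_insert_self _ _, mem_insert_of_mem (mem_insert_self _ _)⟩, ?_⟩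
    have hij : i ≠ j := fun h => by
      have := congrArg Fin.val h; omega
    rw [erase_insert (by simp [hij, his]), erase_insert hjs]

/-- In a shifted lower family, a set with two elements beyond `T`, one of which is beyond `h`,
forces all pairs `{i, j}` with `i < T ≤ j < h`. -/
lemma pair_mem_of_shifted (hlow : ∀ s ∈ 𝓑, ∀ t ⊆ s, t ∈ 𝓑)
    (hshift : ∀ s ∈ 𝓑, ∀ i j, i < j → j ∈ s → i ∉ s → insert i (s.erase j) ∈ 𝓑)
    {T h : ℕ} {s : Finset (Fin n)} (hs : s ∈ 𝓑)
    (h2 : 2 ≤ (s.filter fun i => T ≤ i.val).card) (hq : ∃ q ∈ s, h ≤ q.val)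
    {i j : Fin n} (hi : i.val < T) (hj : T ≤ j.val) (hjh : j.val < h) :
    ({i, j} : Finset (Fin n)) ∈ 𝓑 := by
  obtain ⟨q, hqs, hq⟩ := hq
  obtain ⟨p, hp, hpq⟩ := exists_mem_ne (by omega) q (s := s.filter fun i => T ≤ i.val)
  simp only [mem_filter] at hp
  have hiq : i ≠ q := fun e => by have := congrArg Fin.val e; omega
  have hip : i ≠ p := fun e => by have := congrArg Fin.val e; omega
  have hij : i ≠ j := fun e => by have := congrArg Fin.val e; omega
  have hjq : j ≠ q := fun e => by have := congrArg Fin.val e; omega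
  have m1 : ({p, q} : Finset (Fin n)) ∈ 𝓑 := hlow s hs _ (by
    intro x hx; simp only [mem_insert, mem_singleton] at hx
    rcases hx with rfl | rfl
    exacts [hp.1, hqs])
  have m2 := hshift _ m1 i p (show i.val < p.val by omega) (by simp) (by simp [hiq, hip])
  rw [erase_insert (by simpa using hpq)] at m2
  have m3 := hshift _ m2 j q (show j.val < q.val by omega) (by simp) (by simp [hij.symm, hjq])
  convert m3 using 1
  ext x
  simp only [mem_insert, mem_singleton, mem_erase]
  constructor
  · rintro (rfl | rfl)
    · exact Or.inr ⟨hiq, Or.inl rfl⟩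
    · exact Or.inl rfl
  · tauto

/-- The two counting inequalities for shifted lower families. -/
lemma shifted_family_bounds (hlow : ∀ s ∈ 𝓑, ∀ t ⊆ s, t ∈ 𝓑)
    (hshift : ∀ s ∈ 𝓑, ∀ i j, i < j → j ∈ s → i ∉ s → insert i (s.erase j) ∈ 𝓑)
    (hsing : ∀ i, {i} ∈ 𝓑) (hD : ∀ s ∈ 𝓑, ∀ t ∈ 𝓑, Disjoint s t → s ∪ t ∈ 𝓓)
    {K T h : ℕ} (hK : ∀ s ∈ 𝓑, s.card ≤ K) (hT : T ≤ n) (hh : 2 * h ≤ n) :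
    ∃ b ≤ 𝓑.card, b * ((T - K) * (h - T - K)) ≤ 𝓓.card * (K + 2) ^ 2 ∧
      (𝓑.card - b) * (n - T - 1) ≤ 2 * 𝓓.card := by
  classical
  have hD1 : ∀ s ∈ 𝓑, ∀ j ∉ s, insert j s ∈ 𝓓 := fun s hs j hj => by
    rw [insert_eq, union_comm]
    exact hD s hs _ (hsing j) (by simpa using hj)
  set N : Finset (Fin n) → ℕ := fun s => (s.filter fun i => T ≤ i.val).card with hN
  refine ⟨(𝓑.filter fun s => 2 ≤ N s ∧ ∃ q ∈ s, h ≤ q.val).card, card_filter_le _ _, ?_, ?_⟩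
  · refine card_mul_le_of_insert_pairs hT (by omega) (fun s hs => hK s (mem_filter.1 hs).1) ?_
    intro s hs i j hi hj hjh his hjs
    simp only [mem_filter] at hs
    have := hD s hs.1 _ (pair_mem_of_shifted hlow hshift hs.1 hs.2.1 hs.2.2 hi hj hjh)
      (by simp [his, hjs])
    convert this using 1
    ext x; simp only [mem_insert, mem_union, mem_singleton]; tauto
  · have e0 := card_level_mul_le hD1 T 0
    have e1 := card_level_mul_le hD1 T 1
    have e2 := card_bounded_mul_le hD1 T h
    have hB : 𝓑.card ≤ (𝓑.filter fun s => N s = 0).card + (𝓑.filter fun s => N s = 1).card +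
        (𝓑.filter fun s => 2 ≤ N s ∧ ∀ i ∈ s, i.val < h).card +
        (𝓑.filter fun s => 2 ≤ N s ∧ ∃ q ∈ s, h ≤ q.val).card := by
      refine le_trans (card_le_card fun s hs => ?_) ((card_union_le _ _).trans
        (Nat.add_le_add_right ((card_union_le _ _).trans
          (Nat.add_le_add_right (card_union_le _ _) _)) _))
      simp only [mem_union, mem_filter, hs, true_and]
      by_cases hb : ∃ q ∈ s, h ≤ q.val
      · have : N s = 0 ∨ N s = 1 ∨ 2 ≤ N s := by omega
        tauto
      · have hb' : ∀ i ∈ s, i.val < h := by push Not at hb; exact hb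
        have : N s = 0 ∨ N s = 1 ∨ 2 ≤ N s := by omega
        tauto
    have hDD : (𝓓.filter fun s => N s = 0 + 1).card + (𝓓.filter fun s => N s = 1 + 1).card +
        (𝓓.filter fun s => 3 ≤ N s).card ≤ 𝓓.card := by
      rw [← card_union_of_disjoint, ← card_union_of_disjoint]
      · exact card_le_card (union_subset (union_subset (filter_subset _ _) (filter_subset _ _))
          (filter_subset _ _))
      · rw [disjoint_left]; intro s; simp only [mem_union, mem_filter]; omega
      · rw [disjoint_left]; intro s; simp only [mem_filter]; omega
    change (𝓑.filter fun s => N s = 0).card * _ ≤ (𝓓.filter fun s => N s = 0 + 1).card * _ at e0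
    change (𝓑.filter fun s => N s = 1).card * _ ≤ (𝓓.filter fun s => N s = 1 + 1).card * _ at e1
    change (𝓑.filter fun s => 2 ≤ N s ∧ ∀ i ∈ s, i.val < h).card * _ ≤
      (𝓓.filter fun s => 3 ≤ N s).card at e2
    have f0 := (Nat.mul_le_mul_left (𝓑.filter fun s => N s = 0).card
      (show n - T - 1 ≤ n - T - 0 by omega)).trans e0
    have f2 := (Nat.mul_le_mul_left
      (𝓑.filter fun s => 2 ≤ N s ∧ ∀ i ∈ s, i.val < h).card
      (show n - T - 1 ≤ 2 * (n - h) by omega))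
    have f3 := Nat.mul_le_mul_right (n - T - 1) (Nat.sub_le_iff_le_add.2 hB)
    refine f3.trans ?_
    rw [add_mul, add_mul]
    have : (𝓑.filter fun s => 2 ≤ N s ∧ ∀ i ∈ s, i.val < h).card * (2 * (n - h)) =
      2 * ((𝓑.filter fun s => 2 ≤ N s ∧ ∀ i ∈ s, i.val < h).card * (n - h)) := by ring
    omega

end Families

/-- The two counting inequalities for the doubling of a set containing the coordinate vectors. -/
lemma doubling_bounds {n : ℕ} (B : Finset (F2 n)) (h0 : (0 : F2 n) ∈ B)
    (h1 : ∀ i, stdBasis i ∈ B) {K T h : ℕ} (hK : B.card < 2 ^ (K + 1)) (hT : T ≤ n)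
    (hh : 2 * h ≤ n) :
    ∃ b ≤ B.card, b * ((T - K) * (h - T - K)) ≤ (B + B).card * (K + 2) ^ 2 ∧
      (B.card - b) * (n - T - 1) ≤ 2 * (B + B).card := by
  classical
  obtain ⟨B', hc, hs, hz, he, hdown, hshift⟩ := exists_compressed B h0 h1
  have hcard : ∀ X : Finset (F2 n), (univ.filter fun s => indVec s ∈ X).card = X.card := by
    intro X
    rw [← card_image_of_injective _ indVec_injective]
    congr 1
    ext x
    simp only [mem_image, mem_filter, mem_univ, true_and]
    constructor
    · rintro ⟨s, hs, rfl⟩; exact hs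
    · exact fun hx => ⟨_, by rwa [indVec_filter], indVec_filter x⟩
  have herase : ∀ s : Finset (Fin n), indVec s ∈ B' → ∀ j ∈ s, indVec (s.erase j) ∈ B' := by
    intro s hs j hj
    rw [← indVec_add_stdBasis_of_mem hj]
    exact hdown _ hs j (by simp [indVec, hj])
  have hsdiff : ∀ u s : Finset (Fin n), indVec s ∈ B' → indVec (s \ u) ∈ B' := by
    intro u
    induction u using Finset.induction_on with
    | empty => intro s hs; simpa using hs
    | insert a u ha ih =>
      intro s hs
      rw [sdiff_insert]
      by_cases h : a ∈ s \ u
      · exact herase _ (ih s hs) a h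
      · rw [erase_eq_of_notMem h]; exact ih s hs
  have hlow : ∀ s ∈ (univ.filter fun s => indVec s ∈ B'), ∀ t ⊆ s,
      t ∈ (univ.filter fun s => indVec s ∈ B') := by
    intro s hs t ht
    simp only [mem_filter, mem_univ, true_and] at hs ⊢
    have := hsdiff (s \ t) s hs
    rwa [Finset.sdiff_sdiff_eq_self ht] at this
  obtain ⟨b, hb, e1, e2⟩ := shifted_family_bounds
    (𝓑 := univ.filter fun s => indVec s ∈ B') (𝓓 := univ.filter fun s => indVec s ∈ B' + B')
    (K := K) (T := T) (h := h) hlow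
    (by
      intro s hs i j hij hj hi
      simp only [mem_filter, mem_univ, true_and] at hs ⊢
      have := hshift _ hs i j hij (by simp [indVec, hj])
      rwa [add_comm (stdBasis i), ← add_assoc, indVec_add_stdBasis_of_mem hj,
        indVec_add_stdBasis_of_notMem (by simp [hi])] at this)
    (by
      intro i
      simp only [mem_filter, mem_univ, true_and]
      convert he i using 1
      ext k
      simp [indVec, stdBasis, Pi.single_apply])
    (by
      intro s hs t ht hst
      simp only [mem_filter, mem_univ, true_and] at hs ht ⊢
      rw [indVec_union hst]
      exact add_mem_add hs ht)
    (by
      intro s hs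
      have h2 : 2 ^ s.card ≤ B.card := by
        rw [← card_powerset, ← hc, ← hcard B']
        exact card_le_card fun t ht => hlow s hs t (mem_powerset.1 ht)
      have := (Nat.pow_lt_pow_iff_right (by norm_num : 1 < 2)).1 (h2.trans_lt hK)
      omega) hT hh
  rw [hcard, hc] at hb e2
  rw [hcard] at e1 e2
  exact ⟨b, hb, e1.trans (Nat.mul_le_mul_right _ hs), e2.trans (Nat.mul_le_mul_left _ hs)⟩

/-- The final estimate, from the two counting inequalities. -/
lemma doubling_numerics {C L r n β δ b K M m : ℝ} (hC : 1 ≤ C) (hL1 : 1 ≤ L) (hr1 : 1 ≤ r)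
    (hrr : r * r = n) (hb0 : 0 ≤ b) (hβ0 : 0 ≤ β) (hK0 : 0 ≤ K) (hM0 : 0 ≤ M)
    (hlarge : δ ≤ n / 2 * β) (hK1 : K ≤ C * L) (hM1 : r * L ≤ M) (hM2 : M ≤ r * L + 1)
    (hmid : n / 4 ≤ m) (e1 : b * (M * m) ≤ δ * (K + 2) ^ 2)
    (e2 : (β - b) * (n - (K + M) - 1) ≤ 2 * δ) :
    (n / 2 - (5 * (C + 2) ^ 2) * r * L) * β ≤ δ := by
  have hn0 : 0 < n := by nlinarith
  have hrL : L ≤ r * L := le_mul_of_one_le_left (by linarith) hr1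
  have hCL : C * L ≤ C * (r * L) := by gcongr
  have hKL : K + 2 ≤ (C + 2) * L := by linarith
  have g1 : b * (r * L * (n / 4)) ≤ (n / 2 * β) * ((C + 2) * L) ^ 2 := by
    calc b * (r * L * (n / 4)) ≤ b * (M * m) := by gcongr
      _ ≤ δ * (K + 2) ^ 2 := e1
      _ ≤ (n / 2 * β) * (K + 2) ^ 2 := by gcongr
      _ ≤ (n / 2 * β) * ((C + 2) * L) ^ 2 := by gcongr
  have g2 : b * r ≤ 2 * β * (C + 2) ^ 2 * L := by
    have hp : 0 < L * (n / 4) := by positivity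
    refine le_of_mul_le_mul_right ?_ hp
    linarith
  have g3 : b * n ≤ 2 * β * (C + 2) ^ 2 * (r * L) := by
    have := mul_le_mul_of_nonneg_right g2 (by linarith : 0 ≤ r)
    rw [← hrr]
    linarith
  have t1 : K + M + 1 ≤ (C + 3) * (r * L) := by linarith
  have t2 := mul_le_mul_of_nonneg_left t1 hβ0
  have t3 : 0 ≤ b * (K + M + 1) := by positivity
  have g4 : β * n - β * ((C + 3) * (r * L)) - b * n ≤ 2 * δ := by linarith
  have g5 : β * ((C + 3) * (r * L)) ≤ β * ((C + 2) ^ 2 * (r * L)) := by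
    gcongr
    nlinarith
  have g6 : 0 ≤ β * ((C + 2) ^ 2 * (r * L)) := by positivity
  linarith

/-- The numerical optimisation behind the lower bound on the doubling. -/
lemma doubling_lower_bound (C : ℝ) (hC : 1 ≤ C) {n : ℕ} (hn : 2 ≤ n) (B : Finset (F2 n))
    (h0 : (0 : F2 n) ∈ B) (h1 : ∀ i, stdBasis i ∈ B) (hcard : (B.card : ℝ) ≤ (n : ℝ) ^ C) :
    ((n : ℝ) / 2 - (5 * (C + 2) ^ 2) * Real.sqrt n * Real.logb 2 n) * B.card ≤
      ((B + B).card : ℝ) := by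
  have hn' : (2 : ℝ) ≤ n := by exact_mod_cast hn
  set L := Real.logb 2 n with hL
  set r := Real.sqrt n with hr
  have hL1 : 1 ≤ L := by
    rw [hL, Real.le_logb_iff_rpow_le (by norm_num) (by linarith)]
    simpa using hn'
  have hr1 : 1 ≤ r := by rw [hr, Real.one_le_sqrt]; linarith
  have hrr : r * r = n := Real.mul_self_sqrt (by linarith)
  have hrL : L ≤ r * L := le_mul_of_one_le_left (by linarith) hr1
  by_cases hbig : (n : ℝ) / 2 ≤ (5 * (C + 2) ^ 2) * r * L
  · exact (mul_nonpos_of_nonpos_of_nonneg (by linarith) (by positivity)).trans (by positivity)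
  by_cases hlarge : (n : ℝ) / 2 * B.card ≤ ((B + B).card : ℝ)
  · refine le_trans ?_ hlarge
    gcongr
    have : 0 ≤ (5 * (C + 2) ^ 2) * r * L := by positivity
    linarith
  push Not at hbig hlarge
  obtain ⟨K, hK⟩ : ∃ K, K = ⌊C * L⌋₊ := ⟨_, rfl⟩
  obtain ⟨M, hM⟩ : ∃ M, M = ⌈r * L⌉₊ := ⟨_, rfl⟩
  have hK1 : (K : ℝ) ≤ C * L := hK ▸ Nat.floor_le (by positivity)
  have hK2 : C * L < K + 1 := hK ▸ Nat.lt_floor_add_one _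
  have hM1 : r * L ≤ M := hM ▸ Nat.le_ceil _
  have hM2 : (M : ℝ) < r * L + 1 := hM ▸ Nat.ceil_lt_add_one (by positivity)
  have hBK : B.card < 2 ^ (K + 1) := by
    have : (B.card : ℝ) < 2 ^ (K + 1) := by
      refine hcard.trans_lt ?_
      have e : (n : ℝ) = 2 ^ L := (Real.rpow_logb (by norm_num) (by norm_num) (by linarith)).symm
      rw [e, ← Real.rpow_mul (by norm_num), mul_comm L C, ← Real.rpow_natCast]
      exact Real.rpow_lt_rpow_of_exponent_lt (by norm_num) (by push_cast; exact hK2)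
    exact_mod_cast this
  have hCL : C * L ≤ C * (r * L) := by gcongr
  have hq : 10 * (3 * (C + 2)) * (r * L) ≤ n := by
    have : 10 * (3 * (C + 2)) * (r * L) ≤ (10 * (C + 2) ^ 2) * (r * L) := by
      gcongr; nlinarith
    nlinarith
  have hhalf : (n : ℝ) / 2 - 1 ≤ ((n / 2 : ℕ) : ℝ) := by
    have : n ≤ 2 * (n / 2) + 1 := by omega
    have : (n : ℝ) ≤ 2 * ((n / 2 : ℕ) : ℝ) + 1 := by exact_mod_cast this
    linarith
  have hCrL : 1 ≤ C * (r * L) := by nlinarith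
  have hTn : ((K + M : ℕ) : ℝ) + 1 ≤ n := by push_cast; nlinarith
  have hTn' : K + M + 1 ≤ n := by exact_mod_cast hTn
  have hmid : (n : ℝ) / 4 ≤ ((n / 2 : ℕ) : ℝ) - (K + M) - K := by nlinarith
  have hmid' : K + M + K ≤ n / 2 := by
    have : ((K + M + K : ℕ) : ℝ) ≤ ((n / 2 : ℕ) : ℝ) := by push_cast; linarith
    exact_mod_cast this
  obtain ⟨b, hb, e1, e2⟩ := doubling_bounds B h0 h1 (T := K + M) (h := n / 2) hBK (by omega)
    (by omega)
  have e1' : (b : ℝ) * (M * (((n / 2 : ℕ) : ℝ) - (K + M) - K)) ≤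
      (B + B).card * ((K : ℝ) + 2) ^ 2 := by
    have := (Nat.cast_le (α := ℝ)).2 e1
    rw [Nat.add_sub_cancel_left] at this
    push_cast [Nat.cast_sub (show K + M ≤ n / 2 by omega),
      Nat.cast_sub (show K ≤ n / 2 - (K + M) by omega)] at this ⊢
    exact this
  have e2' : ((B.card : ℝ) - b) * (n - (K + M) - 1) ≤ 2 * (B + B).card := by
    have := (Nat.cast_le (α := ℝ)).2 e2
    push_cast [Nat.cast_sub hb, Nat.cast_sub (show K + M ≤ n by omega),
      Nat.cast_sub (show 1 ≤ n - (K + M) by omega)] at this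
    exact this
  exact doubling_numerics (by linarith) hL1 hr1 hrr (by positivity) (by positivity) (by positivity)
    (by positivity) hlarge.le hK1 hM1 hM2.le hmid e1' e2'

/-- Freiman's lemma in finite fields (Proposition 5.1): if
`H_1(n) ⊆ B ⊆ A ⊆ F_2^n` and `|A| ≤ n^C`, then
`|A + B| ≥ (n/2 - O(√n log n)) |B|`. -/
theorem freiman_lemma_finite_fields (C : ℝ) (hC : 1 ≤ C) :
    ∃ C' : ℝ, 0 ≤ C' ∧
      ∀ n : ℕ, 1 ≤ n → ∀ A B : Finset (F2 n),
        hamBall n 1 ⊆ B → B ⊆ A → (A.card : ℝ) ≤ (n : ℝ) ^ C →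
        ((n : ℝ) / 2 - C' * Real.sqrt n * Real.logb 2 n) * B.card ≤
          ((A + B).card : ℝ) := by
  refine ⟨5 * (C + 2) ^ 2, by positivity, fun n hn A B hHB hBA hA => ?_⟩
  have h0 := zero_mem_of_hamBall_subset hHB
  have hsub : ((B + B).card : ℝ) ≤ (A + B).card := by
    exact_mod_cast card_le_card (add_subset_add_right hBA)
  refine le_trans ?_ hsub
  rcases hn.eq_or_lt with rfl | hn
  · have h : (B.card : ℝ) ≤ (B + B).card := by
      exact_mod_cast card_le_card (subset_add_left B h0)
    have : (0 : ℝ) ≤ B.card := by positivity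
    simp only [Nat.cast_one, Real.logb_one, mul_zero, sub_zero]
    linarith
  · refine doubling_lower_bound C hC hn B h0 (stdBasis_mem_of_hamBall_subset hHB) ?_
    exact le_trans (by exact_mod_cast card_le_card hBA) hA
end

section
/- Let K be a real number with 7/4 ≤ K < 9/5, and let A ⊆ F_2^n be a nonempty set with |A + A| ≤ K·|A|. Then there exists an affine subspace V ⊆ F_2^n with A ⊆ V and |V| ≤ (8/7)·K·|A|. -/
open Finset Pointwise

section Isoperimetric

variable {V : Type*} [AddCommGroup V] [Module (ZMod 2) V] [Fintype V] [DecidableEq V]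

/-- Hamidoune's theorem on atoms in characteristic two: among the nonempty `X` with `X + A`
not everything, the quantity `|X + A| - |X|` is minimized by a subspace. -/
theorem exists_submodule_card_add_le {A B : Finset V} (hB : B.Nonempty)
    (hBA : B + A ≠ univ) :
    ∃ H : Submodule (ZMod 2) V, ∃ S : Finset V, (∀ x, x ∈ S ↔ x ∈ H) ∧ S + A ≠ univ ∧
      (S + A).card + B.card ≤ (B + A).card + S.card := by
  classical
  have self (x : V) : x + x = 0 := ZModModule.add_self x
  let d : Finset V → ℤ := fun X ↦ (X + A).card - X.card
  let P : Finset (Finset V) := univ.filter fun X ↦ X.Nonempty ∧ X + A ≠ univ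
  have memP (X) : X ∈ P ↔ X.Nonempty ∧ X + A ≠ univ := by simp [P]
  obtain ⟨F, hFP, hF⟩ := P.exists_min_image d ⟨B, (memP B).2 ⟨hB, hBA⟩⟩
  let Q : Finset (Finset V) := P.filter fun X ↦ d X = d F
  obtain ⟨X, hXQ, hX⟩ := Q.exists_min_image card ⟨F, by simp [Q, hFP]⟩
  obtain ⟨hXP, hXd⟩ := mem_filter.1 hXQ
  have card_le {Y} (hY : Y ∈ P) (hYd : d Y ≤ d F) : X.card ≤ Y.card :=
    hX Y (mem_filter.2 ⟨hY, hYd.antisymm (hF Y hY)⟩)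
  obtain ⟨hXne, hXA⟩ := (memP X).1 hXP
  -- the complement of `X + A` is again a minimizer
  have dual : 2 * (X.card : ℤ) + d F ≤ Fintype.card V := by
    have hsub : (X + A)ᶜ + A ⊆ Xᶜ := by
      intro y hy
      obtain ⟨u, hu, a, ha, rfl⟩ := mem_add.1 hy
      rw [mem_compl] at hu ⊢
      refine fun h ↦ hu (mem_add.2 ⟨_, h, a, ha, ?_⟩)
      rw [add_assoc, self, add_zero]
    have hP : (X + A)ᶜ ∈ P := by
      refine (memP _).2 ⟨?_, fun h ↦ ?_⟩
      · rwa [nonempty_iff_ne_empty, Ne, compl_eq_empty_iff]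
      · obtain ⟨x, hx⟩ := hXne
        have := hsub (h ▸ mem_univ x)
        exact mem_compl.1 this hx
    have h1 := card_le_card hsub
    have h2 := card_add_card_compl X
    have h3 := card_add_card_compl (X + A)
    have hle : d (X + A)ᶜ ≤ d F := by
      rw [← hXd]
      simp only [d]
      omega
    have h4 := card_le hP hle
    simp only [← hXd, d]
    omega
  have card_vadd (x : V) (Y : Finset V) : (x +ᵥ Y).card = Y.card := card_vadd_finset x Y
  have translate (x : V) : (x +ᵥ X) ∈ P ∧ d (x +ᵥ X) = d F := by
    have h : (x +ᵥ X) + A = x +ᵥ (X + A) := vadd_add_assoc x X A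
    refine ⟨(memP _).2 ⟨hXne.vadd_finset, fun h' ↦ hXA ?_⟩, ?_⟩
    · rw [← card_eq_iff_eq_univ] at h' ⊢
      rwa [h, card_vadd] at h'
    · simp only [← hXd, d, h, card_vadd]
  -- distinct translates of the atom `X` are disjoint
  have atom {Y Z : Finset V} (hY : Y ∈ P) (hYd : d Y = d F) (hYX : Y.card = X.card)
      (hZ : Z ∈ P) (hZd : d Z = d F) (hZX : Z.card = X.card) (h : (Y ∩ Z).Nonempty) : Y = Z := by
    have h1 : ((Y ∩ Z) + A).card + ((Y ∪ Z) + A).card ≤ (Y + A).card + (Z + A).card := by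
      rw [union_add, ← card_inter_add_card_union (Y + A)]
      gcongr
      exact inter_add_subset
    have h2 := card_inter_add_card_union Y Z
    have hI : Y ∩ Z ∈ P := (memP _).2 ⟨h, fun h' ↦ ((memP Y).1 hY).2 <|
      univ_subset_iff.1 <| h' ▸ add_subset_add_right inter_subset_left⟩
    have h3 := hF _ hI
    have h4 := h.card_pos
    have h5 : d (Y ∩ Z) ≤ d F := by
      by_cases hU : (Y ∪ Z) + A = univ
      · have := card_eq_iff_eq_univ _ |>.2 hU
        simp only [d] at *
        omega
      · have := hF _ ((memP _).2 ⟨(h.mono (inter_subset_left.trans subset_union_left)), hU⟩)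
        simp only [d] at *
        omega
    have h6 := card_le hI h5
    have hYI : Y ∩ Z = Y := eq_of_subset_of_card_le inter_subset_left (by omega)
    exact eq_of_subset_of_card_le (inter_eq_left.1 hYI) (by omega)
  obtain ⟨x₀, hx₀⟩ := hXne
  let S := x₀ +ᵥ X
  have zero_mem : (0 : V) ∈ S := mem_vadd_finset.2 ⟨x₀, hx₀, self x₀⟩
  have add_mem {x y : V} (hx : x ∈ S) (hy : y ∈ S) : x + y ∈ S := by
    have hS : x +ᵥ S = S := by
      have h := translate (x + x₀)
      rw [add_vadd] at h
      refine atom h.1 h.2 ?_ (translate x₀).1 (translate x₀).2 (card_vadd _ _) ⟨x, ?_⟩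
      · rw [card_vadd, card_vadd]
      · exact mem_inter.2 ⟨mem_vadd_finset.2 ⟨0, zero_mem, add_zero x⟩, hx⟩
    rw [← hS]
    exact mem_vadd_finset.2 ⟨y, hy, rfl⟩
  let H : AddSubgroup V :=
    { carrier := S
      zero_mem' := zero_mem
      add_mem' := add_mem
      neg_mem' := fun {x} hx ↦ by rwa [ZModModule.neg_eq_self x] }
  refine ⟨AddSubgroup.toZModSubmodule 2 H, S, fun x ↦ Iff.rfl, ((memP _).1 (translate x₀).1).2, ?_⟩
  have h := hF B ((memP B).2 ⟨hB, hBA⟩)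
  rw [← (translate x₀).2] at h
  simp only [d] at h
  change (((x₀ +ᵥ X) + A).card) + B.card ≤ (B + A).card + (x₀ +ᵥ X).card
  omega

theorem seven_mul_card_le_of_card_le_four {A : Finset V} (h0 : 0 ∈ A)
    (hspan : Submodule.span (ZMod 2) (A : Set V) = ⊤) (hcard : A.card ≤ 4) :
    7 * Fintype.card V ≤ 8 * (A + A).card := by
  have self (x : V) : x + x = 0 := ZModModule.add_self x
  obtain ⟨x, y, z, rfl⟩ : ∃ x y z, A = {0, x, y, z} := by
    have h : (A.erase 0).card ≤ 3 := by rw [card_erase_of_mem h0]; omega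
    rw [← insert_erase h0]
    generalize A.erase 0 = B at h
    obtain h | h | h | h : B.card = 0 ∨ B.card = 1 ∨ B.card = 2 ∨ B.card = 3 := by omega
    · exact ⟨0, 0, 0, by simp [card_eq_zero.1 h]⟩
    · obtain ⟨x, rfl⟩ := card_eq_one.1 h
      exact ⟨x, x, x, by simp⟩
    · obtain ⟨x, y, -, rfl⟩ := card_eq_two.1 h
      exact ⟨x, y, y, by simp⟩
    · obtain ⟨x, y, z, -, -, -, rfl⟩ := card_eq_three.1 h
      exact ⟨x, y, z, rfl⟩
  set A : Finset V := {0, x, y, z} with hA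
  have hsub : ({0, x, y, z, x + y, x + z, y + z} : Finset V) ⊆ A + A := by
    have mem {a b : V} (ha : a ∈ A) (hb : b ∈ A) : a + b ∈ A + A := add_mem_add ha hb
    have hx : x ∈ A := by simp [hA]
    have hy : y ∈ A := by simp [hA]
    have hz : z ∈ A := by simp [hA]
    intro w hw
    simp only [mem_insert, mem_singleton] at hw
    rcases hw with rfl | rfl | rfl | rfl | rfl | rfl | rfl
    · simpa using mem h0 h0
    · simpa using mem h0 hx
    · simpa using mem h0 hy
    · simpa using mem h0 hz
    · exact mem hx hy
    · exact mem hx hz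
    · exact mem hy hz
  have huniv : insert (x + y + z) (A + A) = univ := by
    rw [eq_univ_iff_forall]
    intro w
    have hw : w ∈ Submodule.span (ZMod 2) ({0, x, y, z} : Set V) := by
      have : ((A : Finset V) : Set V) = {0, x, y, z} := by simp [hA]
      rw [← this, hspan]
      trivial
    rw [Submodule.span_insert_zero, Submodule.mem_span_triple] at hw
    obtain ⟨a, b, c, rfl⟩ := hw
    by_cases habc : a = 1 ∧ b = 1 ∧ c = 1
    · simp [habc]
    · refine mem_insert_of_mem (hsub ?_)
      have two (t : ZMod 2) : t = 0 ∨ t = 1 := by revert t; decide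
      rcases two a with rfl | rfl <;> rcases two b with rfl | rfl <;>
        rcases two c with rfl | rfl <;> simp at habc ⊢
  have hV : Fintype.card V ≤ (A + A).card + 1 := by
    rw [← card_univ, ← huniv]
    exact card_insert_le _ _
  by_cases hmem : x + y + z ∈ A + A
  · rw [insert_eq_self.2 hmem] at huniv
    rw [huniv, card_univ]
    omega
  · have h7 : ({0, x, y, z, x + y, x + z, y + z} : Finset V).card = 7 := by
      have hne : x + y + z ∉ ({0, x, y, z, x + y, x + z, y + z} : Finset V) :=
        fun h ↦ hmem (hsub h)
      simp only [mem_insert, mem_singleton, not_or] at hne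
      obtain ⟨h1, h2, h3, h4, h5, h6, h7⟩ := hne
      have hx := self x
      have hy := self y
      have hz := self z
      repeat rw [card_insert_of_notMem]
      · simp
      all_goals
        simp only [mem_insert, mem_singleton, not_or]
        grind
    have := card_le_card hsub
    omega

theorem card_filter_mkQ_mem (H : Submodule (ZMod 2) V) [DecidableEq (V ⧸ H)]
    (s : Finset (V ⧸ H)) :
    (univ.filter fun v ↦ H.mkQ v ∈ s).card = s.card * Nat.card H := by
  classical
  have hmaps : Set.MapsTo H.mkQ (univ.filter fun v ↦ H.mkQ v ∈ s : Finset V) s :=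
    fun v hv ↦ (mem_filter_univ v).1 (mem_coe.1 hv)
  rw [card_eq_sum_card_fiberwise hmaps, sum_const_nat]
  intro q hq
  obtain ⟨a, rfl⟩ := H.mkQ_surjective q
  have hcard : Nat.card H = (univ.filter (· ∈ H)).card := Nat.subtype_card _ mem_filter_univ
  rw [hcard, ← card_vadd_finset a (univ.filter (· ∈ H))]
  congr 1
  ext v
  simp only [mem_filter, mem_univ, true_and, mem_vadd_finset, vadd_eq_add]
  constructor
  · rintro ⟨-, hv⟩
    exact ⟨v - a, (Submodule.Quotient.eq H).1 hv, add_sub_cancel a v⟩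
  · rintro ⟨w, hw, rfl⟩
    have : H.mkQ (a + w) = H.mkQ a := (Submodule.Quotient.eq H).2 (by simpa using hw)
    exact ⟨this ▸ hq, this⟩

theorem seven_mul_card_le_eight_mul_card_add_self {A : Finset V} (h0 : 0 ∈ A)
    (hspan : Submodule.span (ZMod 2) (A : Set V) = ⊤)
    (hdouble : 5 * (A + A).card < 9 * A.card) :
    7 * Fintype.card V ≤ 8 * (A + A).card := by
  classical
  by_cases hAA : A + A = univ
  · rw [hAA, card_univ]
    omega
  obtain ⟨H, S, hS, hSA, hle⟩ := exists_submodule_card_add_le ⟨0, h0⟩ hAA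
  have self (x : V) : x + x = 0 := ZModModule.add_self x
  let _ : Fintype (V ⧸ H) := Fintype.ofFinite _
  set h := Nat.card H with hh
  set A' := A.image H.mkQ with hA'
  set T := univ.filter fun v ↦ H.mkQ v ∈ A' with hT
  have memT (v) : v ∈ T ↔ H.mkQ v ∈ A' := mem_filter_univ v
  have hTcard : T.card = A'.card * h := card_filter_mkQ_mem H A'
  have hScard : S.card = h := (Nat.subtype_card S hS).symm
  have hST : S + A = T := by
    ext v
    rw [memT, mem_add, hA', mem_image]
    constructor
    · rintro ⟨s, hs, a, ha, rfl⟩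
      exact ⟨a, ha, (Submodule.Quotient.eq H).2 (by
        simpa using H.neg_mem ((hS s).1 hs))⟩
    · rintro ⟨a, ha, hav⟩
      exact ⟨v - a, (hS _).2 ((Submodule.Quotient.eq H).1 hav.symm), a, ha, sub_add_cancel v a⟩
  have hAT : A ⊆ T := fun a ha ↦ (memT a).2 (mem_image_of_mem _ ha)
  have h0' : (0 : V ⧸ H) ∈ A' := mem_image.2 ⟨0, h0, map_zero _⟩
  have hspan' : Submodule.span (ZMod 2) (A' : Set (V ⧸ H)) = ⊤ := by
    rw [hA', coe_image, Submodule.span_image, hspan, Submodule.map_top, Submodule.range_mkQ]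
  rw [hST, hTcard, hScard] at hle
  have hpos : 0 < h := Nat.card_pos
  have hAle : A.card ≤ A'.card * h := hTcard ▸ card_le_card hAT
  have hfour : A'.card ≤ 4 := by
    by_contra! hlt
    nlinarith
  have htwo : 2 ≤ A'.card := by
    by_contra! hlt
    have hone : A' = {0} := by
      refine (eq_of_subset_of_card_le (singleton_subset_iff.2 h0') ?_).symm
      rw [card_singleton]
      omega
    rw [hone, coe_singleton, Submodule.span_zero_singleton] at hspan'
    refine hSA (hST.trans (eq_univ_iff_forall.2 fun v ↦ (memT v).2 ?_))
    rw [hone, mem_singleton, ← Submodule.mem_bot (ZMod 2), hspan']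
    trivial
  have hfull : (univ.filter fun v ↦ H.mkQ v ∈ A' + A') ⊆ A + A := by
    intro x hx
    rw [mem_filter] at hx
    obtain ⟨a, ha, b, hb, hab⟩ := mem_add.1 hx.2
    by_contra hxA
    have hlarge : 2 ≤ (A'.filter fun q ↦ q + H.mkQ x ∈ A').card := by
      by_cases hx0 : H.mkQ x = 0
      · simpa [hx0] using htwo
      · have hne : a ≠ b := by
          rintro rfl
          exact hx0 (by rw [← hab, ZModModule.add_self])
        refine (card_pair hne).symm.le.trans <| card_le_card (insert_subset (mem_filter.2 ⟨ha, ?_⟩)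
          (singleton_subset_iff.2 (mem_filter.2 ⟨hb, ?_⟩)))
        · rwa [← hab, ← add_assoc, ZModModule.add_self, zero_add]
        · rwa [← hab, add_left_comm, ZModModule.add_self, add_zero]
    have hcount := card_filter_mkQ_mem H (A'.filter fun q ↦ q + H.mkQ x ∈ A')
    have hsub : (univ.filter fun v ↦ H.mkQ v ∈ A'.filter fun q ↦ q + H.mkQ x ∈ A') ⊆
        (T \ A) ∪ (x +ᵥ (T \ A)) := by
      intro y hy
      simp only [mem_filter, mem_univ, true_and, ← map_add, ← memT] at hy
      rw [mem_union]
      by_cases hyA : y ∈ A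
      · right
        refine mem_vadd_finset.2 ⟨y + x, mem_sdiff.2 ⟨hy.2, fun hyx ↦ hxA ?_⟩, ?_⟩
        · refine mem_add.2 ⟨y, hyA, _, hyx, ?_⟩
          rw [← add_assoc, self, zero_add]
        · rw [vadd_eq_add, add_left_comm, self, add_zero]
      · exact Or.inl (mem_sdiff.2 ⟨hy.1, hyA⟩)
    have h1 := (card_le_card hsub).trans (card_union_le _ _)
    rw [card_vadd_finset, hcount, ← hh, card_sdiff_of_subset hAT, hTcard] at h1
    have h2 : 2 * h ≤ (A'.filter fun q ↦ q + H.mkQ x ∈ A').card * h := by gcongr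
    have h3 : 2 * h ≤ A'.card * h := by gcongr
    omega
  have h1 := card_le_card hfull
  rw [card_filter_mkQ_mem] at h1
  have h2 := seven_mul_card_le_of_card_le_four h0' hspan' hfour
  have h3 := card_filter_mkQ_mem H univ
  simp only [mem_univ, filter_true, card_univ] at h3
  rw [h3]
  nlinarith

end Isoperimetric

/-- `F(K) ≤ (8/7)K` for `7/4 ≤ K < 9/5` (Proposition 6.1): if `7/4 ≤ K < 9/5`
and `|A+A| ≤ K|A|`, then `A` is contained in an affine subspace of size at most
`(8/7)K|A|`. -/
theorem F_small_K_second_range {n : ℕ} (K : ℝ) (hK1 : 7 / 4 ≤ K) (hK2 : K < 9 / 5)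
    (A : Finset (F2 n)) (hA : A.Nonempty)
    (hdouble : ((A + A).card : ℝ) ≤ K * A.card) :
    ∃ (W : Submodule (ZMod 2) (F2 n)) (t : F2 n),
      (↑A : Set (F2 n)) ⊆ t +ᵥ (W : Set (F2 n)) ∧
      (Nat.card W : ℝ) ≤ 8 / 7 * K * A.card := by
  classical
  obtain ⟨t, ht⟩ := hA
  have self (x : F2 n) : x + x = 0 := ZModModule.add_self x
  set B : Finset (F2 n) := t +ᵥ A with hB
  set W := Submodule.span (ZMod 2) (B : Set (F2 n)) with hW
  have hBW (x) (hx : x ∈ B) : x ∈ W := Submodule.subset_span hx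
  set C : Finset W := B.subtype (· ∈ W) with hC
  have hCB : C.map (Function.Embedding.subtype _) = B := subtype_map_of_mem hBW
  have hCimage : C.image W.subtype = B := by rw [← hCB, map_eq_image]; rfl
  have hCcard : C.card = A.card := by
    rw [← card_map (Function.Embedding.subtype _), hCB, card_vadd_finset]
  have hCCcard : (C + C).card = (A + A).card := by
    rw [← card_image_of_injective (C + C) W.injective_subtype, image_add, hCimage, hB,
      vadd_add_vadd_comm, card_vadd_finset]
  have h0 : 0 ∈ C := mem_subtype.2 (mem_vadd_finset.2 ⟨t, ht, self t⟩)
  have hspan : Submodule.span (ZMod 2) (C : Set W) = ⊤ := by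
    apply Submodule.map_injective_of_injective W.injective_subtype
    rw [← Submodule.span_image, ← coe_image, hCimage, Submodule.map_top, Submodule.range_subtype]
  have hApos : (0 : ℝ) < A.card := by exact_mod_cast card_pos.2 ⟨t, ht⟩
  have hsmall : 5 * (C + C).card < 9 * C.card := by
    rw [hCcard, hCCcard]
    have : (5 * (A + A).card : ℝ) < 9 * A.card := by nlinarith
    exact_mod_cast this
  have key := seven_mul_card_le_eight_mul_card_add_self h0 hspan hsmall
  rw [hCCcard, ← Nat.card_eq_fintype_card] at key
  refine ⟨W, t, fun a ha ↦ Set.mem_vadd_set.2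
    ⟨t + a, hBW _ (mem_vadd_finset.2 ⟨a, ha, rfl⟩), ?_⟩, ?_⟩
  · rw [vadd_eq_add, ← add_assoc, self, zero_add]
  · have key' : (7 * Nat.card W : ℝ) ≤ 8 * (A + A).card := by exact_mod_cast key
    linarith
end

section
/- Let K be a real number with 1 ≤ K < 7/4, and let A ⊆ F_2^n be a nonempty set with |A + A| ≤ K·|A|. Then there exist a linear subspace H ⊆ F_2^n with |H| ≤ |A| and elements t₁, t₂ ∈ F_2^n such that A ⊆ (t₁ + H) ∪ (t₂ + H). -/
open Finset Pointwise

/-- In a finite abelian group, among the nonempty sets `X` with `X + A ≠ univ` for a symmetric `A`,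
the quantity `|X + A| - |X|` is minimised by a subgroup. -/
theorem exists_addSubgroup_isoperimetric {G : Type*} [AddCommGroup G] [Fintype G] [DecidableEq G]
    {A : Finset G} (hsymm : -A = A) {X₀ : Finset G} (hX₀ : X₀.Nonempty)
    (hX₀A : X₀ + A ≠ univ) :
    ∃ (H : AddSubgroup G) (M : Finset G), (∀ x, x ∈ M ↔ x ∈ H) ∧ M + A ≠ univ ∧
      ∀ X : Finset G, X.Nonempty → X + A ≠ univ → #(M + A) + #X ≤ #(X + A) + #M := by
  obtain ⟨N, hN, hNmin⟩ := exists_min_image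
    (univ.filter fun X : Finset G => X.Nonempty ∧ X + A ≠ univ)
    (fun X => (#(X + A) : ℤ) - #X) ⟨X₀, by simp [hX₀, hX₀A]⟩
  obtain ⟨P, hP, hPmin⟩ := exists_min_image
    (univ.filter fun X : Finset G => (X.Nonempty ∧ X + A ≠ univ) ∧
      (#(X + A) : ℤ) - #X = (#(N + A) : ℤ) - #N) (fun X => #X) ⟨N, by simpa using hN⟩
  simp only [mem_filter, mem_univ, true_and] at hN hNmin hP hPmin
  obtain ⟨⟨⟨p, hp⟩, hPA⟩, hPN⟩ := hP
  have hvadd : ∀ (g : G) (X : Finset G), (g +ᵥ X) + A = g +ᵥ (X + A) := fun g X =>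
    vadd_add_assoc g X A
  have hvuniv : ∀ (g : G) (X : Finset G), X ≠ univ → g +ᵥ X ≠ univ := by
    intro g X hX h
    apply hX
    rw [← card_eq_iff_eq_univ] at h ⊢
    simpa using h
  set M := -p +ᵥ P with hM
  have hMcard : #M = #P := card_vadd_finset _ _
  have hMAcard : #(M + A) = #(P + A) := by rw [hM, hvadd, card_vadd_finset]
  have hM0 : (0 : G) ∈ M := by
    rw [hM, mem_vadd_finset]
    exact ⟨p, hp, by simp⟩
  have hMA : M + A ≠ univ := by
    rw [hM, hvadd]
    exact hvuniv _ _ hPA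
  have hmin : ∀ X : Finset G, X.Nonempty → X + A ≠ univ → #(M + A) + #X ≤ #(X + A) + #M := by
    intro X h1 h2
    have := hNmin X ⟨h1, h2⟩
    omega
  have hatom : ∀ X : Finset G, X.Nonempty → X + A ≠ univ → #(X + A) + #M ≤ #(M + A) + #X →
      #M ≤ #X := by
    intro X h1 h2 h3
    have := hNmin X ⟨h1, h2⟩
    rw [hMcard]
    exact hPmin X ⟨⟨h1, h2⟩, by omega⟩
  have hlarge : #M + #(M + A) ≤ Fintype.card G := by
    have hne : (M + A)ᶜ.Nonempty := by
      rw [nonempty_iff_ne_empty, Ne, compl_eq_empty_iff]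
      exact hMA
    have hdisj : Disjoint ((M + A)ᶜ + A) M := by
      rw [Finset.disjoint_left]
      intro z hz hzM
      obtain ⟨c, hc, a, ha, rfl⟩ := mem_add.1 hz
      refine mem_compl.1 hc (mem_add.2 ⟨c + a, hzM, -a, ?_, by simp⟩)
      rw [← hsymm]
      exact neg_mem_neg ha
    have hcard : #((M + A)ᶜ + A) + #M ≤ Fintype.card G := by
      rw [← card_union_of_disjoint hdisj]
      exact card_le_univ _
    have hpos : 0 < #M := card_pos.2 ⟨0, hM0⟩
    have hcompl := card_add_card_compl (M + A)
    have := hatom _ hne (fun h => by rw [h, card_univ] at hcard; omega) (by omega)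
    omega
  have hinter : ∀ g : G, ((g +ᵥ M) ∩ M).Nonempty → g +ᵥ M = M := by
    intro g hg
    have hc1 : #(g +ᵥ M) = #M := card_vadd_finset _ _
    have hc2 : #((g +ᵥ M) + A) = #(M + A) := by rw [hvadd, card_vadd_finset]
    have hsub1 : ((g +ᵥ M) ∩ M) + A ⊆ ((g +ᵥ M) + A) ∩ (M + A) := inter_add_subset
    have hc3 := card_le_card hsub1
    have hc4 := card_union_add_card_inter ((g +ᵥ M) + A) (M + A)
    rw [← union_add] at hc4
    have hc5 := card_union_add_card_inter (g +ᵥ M) M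
    have hne1 : ((g +ᵥ M) ∩ M) + A ≠ univ := fun h => by
      apply hMA
      rw [eq_univ_iff_forall] at h ⊢
      exact fun x => add_subset_add_right inter_subset_right (h x)
    have hc6 := hmin _ hg hne1
    have hpos := card_pos.2 hg
    have hne2 : ((g +ᵥ M) ∪ M) + A ≠ univ := fun h => by
      rw [h, card_univ] at hc4
      omega
    have hc7 := hmin _ ⟨0, mem_union_right _ hM0⟩ hne2
    have hc8 := hatom _ hg hne1 (by omega)
    have e1 := eq_of_subset_of_card_le (inter_subset_left (s₁ := g +ᵥ M) (s₂ := M)) (by omega)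
    have e2 := eq_of_subset_of_card_le (inter_subset_right (s₁ := g +ᵥ M) (s₂ := M)) hc8
    exact e1.symm.trans e2
  refine ⟨AddAction.stabilizer G M, M, fun x => ?_, hMA, hmin⟩
  rw [AddAction.mem_stabilizer_iff]
  have hx : x ∈ x +ᵥ M := mem_vadd_finset.2 ⟨0, hM0, by simp⟩
  exact ⟨fun h => hinter x ⟨x, mem_inter.2 ⟨hx, h⟩⟩, fun h => h ▸ hx⟩

/-- The subgroup `H ∪ (x + H)` of a group of exponent two. -/
def AddSubgroup.insertCoset {G : Type*} [AddCommGroup G] (h2 : ∀ x : G, x + x = 0)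
    (H : AddSubgroup G) (x : G) : AddSubgroup G where
  carrier := {g | g ∈ H ∨ x + g ∈ H}
  zero_mem' := Or.inl H.zero_mem
  neg_mem' := by
    intro g hg
    rwa [neg_eq_of_add_eq_zero_left (h2 g)]
  add_mem' := by
    rintro a b (ha | ha) (hb | hb)
    · exact Or.inl (H.add_mem ha hb)
    · exact Or.inr (by simpa [add_left_comm] using H.add_mem ha hb)
    · exact Or.inr (by simpa [add_assoc] using H.add_mem ha hb)
    · refine Or.inl ?_
      have h := H.add_mem ha hb
      rwa [add_add_add_comm, h2, zero_add] at h

/-- A set whose size exceeds half of the group has full sumset, in exponent two. -/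
theorem add_self_eq_univ_of_card_lt {G : Type*} [AddCommGroup G] [Fintype G] [DecidableEq G]
    (h2 : ∀ x : G, x + x = 0) {A : Finset G} (hA : Fintype.card G < 2 * #A) :
    A + A = univ := by
  rw [eq_univ_iff_forall]
  intro g
  by_contra hg
  have hdisj : Disjoint (g +ᵥ A) A := by
    rw [Finset.disjoint_left]
    intro z hz hzA
    obtain ⟨a, ha, rfl⟩ := mem_vadd_finset.1 hz
    refine hg (mem_add.2 ⟨_, hzA, a, ha, ?_⟩)
    rw [vadd_eq_add, add_assoc, h2, add_zero]
  have h := card_le_univ ((g +ᵥ A) ∪ A)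
  rw [card_union_of_disjoint hdisj, card_vadd_finset] at h
  omega

/-- A generating set containing `0` of doubling less than `7 / 4` in a group of exponent two
has full sumset. -/
theorem add_self_eq_univ_of_closure_eq_top {G : Type*} [AddCommGroup G] [Fintype G]
    [DecidableEq G] (h2 : ∀ x : G, x + x = 0) {A : Finset G} (h0 : 0 ∈ A)
    (hgen : AddSubgroup.closure (A : Set G) = ⊤) (hA : 4 * #(A + A) < 7 * #A) :
    A + A = univ := by
  by_contra hne
  have hneg : ∀ x : G, -x = x := fun x => neg_eq_of_add_eq_zero_left (h2 x)
  have hsymm : -A = A := by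
    ext x
    simp [hneg]
  obtain ⟨H, M, hMH, hMA, hmin⟩ := exists_addSubgroup_isoperimetric hsymm ⟨0, h0⟩ hne
  have hle := hmin A ⟨0, h0⟩ hne
  have htop : ∀ K : AddSubgroup G, (∀ a ∈ A, a ∈ K) → ∀ g, g ∈ K := by
    intro K hK g
    have : AddSubgroup.closure (A : Set G) ≤ K := (AddSubgroup.closure_le K).2 hK
    rw [hgen] at this
    exact this (AddSubgroup.mem_top g)
  have hAM : #A ≤ #(M + A) :=
    card_le_card fun a ha => mem_add.2 ⟨0, (hMH 0).2 H.zero_mem, a, ha, zero_add a⟩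
  have hcoset : ∀ x g : G, g ∈ x +ᵥ M ↔ x + g ∈ H := by
    intro x g
    rw [← neg_vadd_mem_iff, hneg, vadd_eq_add, hMH]
  have hsub : ∀ x ∈ A, x +ᵥ M ⊆ M + A := by
    intro x hx z hz
    obtain ⟨m, hm, rfl⟩ := mem_vadd_finset.1 hz
    exact mem_add.2 ⟨m, hm, x, hx, add_comm _ _⟩
  have hdisj : ∀ x y : G, x + y ∉ H → Disjoint (x +ᵥ M) (y +ᵥ M) := by
    intro x y hxy
    rw [Finset.disjoint_left]
    intro z hzx hzy
    rw [hcoset] at hzx hzy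
    apply hxy
    have h := H.add_mem hzx hzy
    rwa [add_add_add_comm, h2, add_zero] at h
  have hcard : ∀ x : G, #(x +ᵥ M) = #M := fun x => card_vadd_finset _ _
  have hnotfull : ¬ ∀ g, g ∈ M + A := fun h => hMA (eq_univ_iff_forall.2 h)
  obtain ⟨x, hxA, hx⟩ : ∃ x ∈ A, x ∉ H := by
    by_contra! h
    exact hnotfull fun g => hsub 0 h0 ((hcoset _ _).2 (by simpa using htop H h g))
  obtain ⟨y, hyA, hy⟩ : ∃ y ∈ A, y ∉ H.insertCoset h2 x := by
    by_contra! h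
    refine hnotfull fun g => ?_
    rcases htop _ h g with hg | hg
    · exact hsub 0 h0 ((hcoset _ _).2 (by simpa using hg))
    · exact hsub x hxA ((hcoset _ _).2 hg)
  obtain ⟨hy0, hyx⟩ := not_or.1 hy
  have d1 : Disjoint ((0 : G) +ᵥ M) (x +ᵥ M) := hdisj _ _ (by simpa using hx)
  have d2 : Disjoint (((0 : G) +ᵥ M) ∪ (x +ᵥ M)) (y +ᵥ M) :=
    disjoint_union_left.2 ⟨hdisj _ _ (by simpa using hy0), hdisj _ _ hyx⟩
  have hc : #((((0 : G) +ᵥ M) ∪ (x +ᵥ M)) ∪ (y +ᵥ M)) = 3 * #M := by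
    rw [card_union_of_disjoint d2, card_union_of_disjoint d1, hcard, hcard, hcard]
    ring
  by_cases hcov : ∀ z ∈ A, z ∈ (((0 : G) +ᵥ M) ∪ (x +ᵥ M)) ∪ (y +ᵥ M)
  · have hfull : ∀ g, g ∈ (H.insertCoset h2 x).insertCoset h2 y := by
      refine htop _ fun a ha => ?_
      have := hcov a ha
      simp only [mem_union, hcoset, zero_add] at this
      rcases this with (h | h) | h
      · exact Or.inl (Or.inl h)
      · exact Or.inl (Or.inr h)
      · exact Or.inr (Or.inl h)
    have huniv : univ ⊆ ((((0 : G) +ᵥ M) ∪ (x +ᵥ M)) ∪ (y +ᵥ M)) ∪ ((x + y) +ᵥ M) := by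
      intro g _
      simp only [mem_union, hcoset, zero_add, add_assoc]
      rcases hfull g with (h | h) | (h | h)
      · exact Or.inl (Or.inl (Or.inl h))
      · exact Or.inl (Or.inl (Or.inr h))
      · exact Or.inl (Or.inr h)
      · exact Or.inr h
    have hG := (card_le_card huniv).trans (card_union_le _ _)
    rw [hc, hcard, card_univ] at hG
    have h3 : 3 * #M ≤ #(M + A) := by
      rw [← hc]
      exact card_le_card (union_subset (union_subset (hsub 0 h0) (hsub x hxA)) (hsub y hyA))
    exact hne (add_self_eq_univ_of_card_lt h2 (by omega))
  · push Not at hcov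
    obtain ⟨z, hzA, hz⟩ := hcov
    simp only [mem_union, hcoset, not_or] at hz
    have d3 : Disjoint ((((0 : G) +ᵥ M) ∪ (x +ᵥ M)) ∪ (y +ᵥ M)) (z +ᵥ M) :=
      disjoint_union_left.2 ⟨disjoint_union_left.2 ⟨hdisj _ _ hz.1.1, hdisj _ _ hz.1.2⟩,
        hdisj _ _ hz.2⟩
    have h4 := card_le_card (union_subset (union_subset (union_subset (hsub 0 h0) (hsub x hxA))
      (hsub y hyA)) (hsub z hzA))
    rw [card_union_of_disjoint d3, hc, hcard] at h4
    omega

theorem F2.add_self {n : ℕ} (x : F2 n) : x + x = 0 := by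
  ext i
  exact CharTwo.add_self_eq_zero (x i)

/-- A set of doubling less than `7 / 4` containing `0` spans a group of less than twice its
size. -/
theorem card_closure_lt_two_mul {n : ℕ} {B : Finset (F2 n)} (h0 : 0 ∈ B)
    (hB : 4 * #(B + B) < 7 * #B) :
    Nat.card (AddSubgroup.closure (B : Set (F2 n))) < 2 * #B := by
  classical
  set V := AddSubgroup.closure (B : Set (F2 n)) with hV
  let C : Finset V := univ.filter fun v => (v : F2 n) ∈ B
  have hCB : C.image V.subtype = B := by
    ext b
    simp only [mem_image, C, mem_filter, mem_univ, true_and]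
    exact ⟨fun ⟨v, hv, h⟩ => h ▸ hv, fun hb => ⟨⟨b, AddSubgroup.subset_closure hb⟩, hb, rfl⟩⟩
  have hinj : Function.Injective V.subtype := V.subtype_injective
  have hCcard : #C = #B := by rw [← hCB, card_image_of_injective _ hinj]
  have hCCcard : #(C + C) = #(B + B) := by
    rw [← hCB, ← image_add, card_image_of_injective _ hinj]
  have hgen : AddSubgroup.closure (C : Set V) = ⊤ := by
    have : (C : Set V) = ((↑) ⁻¹' (B : Set (F2 n)) : Set V) := by
      ext v
      simp [C]
    rw [this]
    exact AddSubgroup.closure_closure_coe_preimage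
  have hCC := add_self_eq_univ_of_closure_eq_top (fun x : V => Subtype.ext (F2.add_self _))
    (by simpa [C] using h0) hgen (by omega)
  rw [hCC, card_univ] at hCCcard
  rw [Nat.card_eq_fintype_card]
  omega

/-- `G(K) ≤ 2` for `1 ≤ K < 7/4` (Proposition 6.3): if `|A+A| ≤ K|A|` then `A`
is covered by two translates of a linear subspace of cardinality at most `|A|`. -/
theorem G_small_K_first_range {n : ℕ} (K : ℝ) (hK1 : 1 ≤ K) (hK2 : K < 7 / 4)
    (A : Finset (F2 n)) (hA : A.Nonempty)
    (hdouble : ((A + A).card : ℝ) ≤ K * A.card) :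
    ∃ (H : Submodule (ZMod 2) (F2 n)) (t₁ t₂ : F2 n),
      Nat.card H ≤ A.card ∧
      (↑A : Set (F2 n)) ⊆ (t₁ +ᵥ (H : Set (F2 n))) ∪ (t₂ +ᵥ (H : Set (F2 n))) := by
  classical
  obtain ⟨a, ha⟩ := hA
  have hpos : 0 < #A := card_pos.2 ⟨a, ha⟩
  have hdouble' : 4 * #(A + A) < 7 * #A := by
    have hposR : (0 : ℝ) < #A := by exact_mod_cast hpos
    have : (4 * #(A + A) : ℝ) < 7 * #A := by nlinarith
    exact_mod_cast this
  set B : Finset (F2 n) := a +ᵥ A with hB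
  have hBcard : #B = #A := card_vadd_finset _ _
  have hBB : B + B = A + A := by
    rw [hB, vadd_add_vadd_comm, F2.add_self, zero_vadd]
  have h0 : (0 : F2 n) ∈ B := mem_vadd_finset.2 ⟨a, ha, F2.add_self a⟩
  have hVcard := card_closure_lt_two_mul h0 (by rwa [hBB, hBcard])
  set V := AddSubgroup.closure (B : Set (F2 n)) with hV
  have hAV : ∀ b ∈ A, a + b ∈ V := fun b hb =>
    AddSubgroup.subset_closure (mem_vadd_finset.2 ⟨b, hb, rfl⟩)
  have hmem : ∀ (H : Submodule (ZMod 2) (F2 n)) (t b : F2 n), t + b ∈ H →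
      b ∈ t +ᵥ (H : Set (F2 n)) := fun H t b h =>
    Set.mem_vadd_set.2 ⟨t + b, h, by rw [vadd_eq_add, ← add_assoc, F2.add_self, zero_add]⟩
  by_cases hbot : ∀ v ∈ V, v = 0
  · refine ⟨⊥, a, a, by simpa using hpos, fun b hb => Or.inl (hmem _ _ _ ?_)⟩
    simpa using hbot _ (hAV b hb)
  · push Not at hbot
    obtain ⟨v, hvV, hv⟩ := hbot
    obtain ⟨i, hi⟩ := Function.ne_iff.1 hv
    have hone : ∀ z : ZMod 2, z ≠ 0 → z = 1 := by decide
    have hvi : v i = 1 := hone _ hi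
    let H : Submodule (ZMod 2) (F2 n) :=
      AddSubgroup.toZModSubmodule 2 V ⊓ LinearMap.ker (LinearMap.proj i)
    have hH : ∀ x, x ∈ H ↔ x ∈ V ∧ x i = 0 := fun x => by
      simp [H, AddSubgroup.mem_toZModSubmodule]
    refine ⟨H, a, v + a, ?_, fun b hb => ?_⟩
    · let S : Finset (F2 n) := univ.filter (· ∈ H)
      let T : Finset (F2 n) := univ.filter (· ∈ V)
      have hS : Nat.card H = #S := by
        rw [Nat.card_eq_fintype_card]
        exact Fintype.card_subtype (· ∈ H)
      have hT : Nat.card V = #T := by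
        rw [Nat.card_eq_fintype_card]
        exact Fintype.card_subtype (· ∈ V)
      have hdisj : Disjoint S (v +ᵥ S) := by
        rw [Finset.disjoint_left]
        intro x hx hx'
        obtain ⟨y, hy, rfl⟩ := mem_vadd_finset.1 hx'
        simp only [S, mem_filter, mem_univ, true_and, hH] at hx hy
        have := hx.2
        simp [hvi, hy.2] at this
      have hsub : S ∪ (v +ᵥ S) ⊆ T := by
        intro x hx
        simp only [T, mem_filter, mem_univ, true_and]
        rcases mem_union.1 hx with hx | hx
        · simp only [S, mem_filter, mem_univ, true_and, hH] at hx
          exact hx.1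
        · obtain ⟨y, hy, rfl⟩ := mem_vadd_finset.1 hx
          simp only [S, mem_filter, mem_univ, true_and, hH] at hy
          exact V.add_mem hvV hy.1
      have h := card_le_card hsub
      rw [card_union_of_disjoint hdisj, card_vadd_finset] at h
      omega
    · by_cases hbi : (a + b) i = 0
      · exact Or.inl (hmem _ _ _ ((hH _).2 ⟨hAV b hb, hbi⟩))
      · refine Or.inr (hmem _ _ _ ?_)
        rw [add_assoc]
        refine (hH _).2 ⟨V.add_mem hvV (hAV b hb), ?_⟩
        rw [Pi.add_apply, hvi, hone _ hbi]
        rfl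
end
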